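/- arXiv:2102.05128 — 2 statements merged into one kernel-verified Lean document; each statement's English description precedes it below -/
import Mathlib

section
/- Let γ ⊂ ℙ² be an irreducible conic, let r ≥ 2, and let ℓ₁,…,ℓ_r, m₁,…,m_r be pairwise distinct lines all tangent to γ. Let X = 𝕊(ℓ₁,…,ℓ_r) and Y = 𝕊(m₁,…,m_r) be the corresponding contact star configurations on γ. Then there exists an irreducible homogeneous form of degree r in ℂ[x,y,z] vanishing at every point of X ∪ Y. -/
open MvPolynomial

noncomputable section

abbrev P2 : Type := Projectivization ℂ (Fin 3 → ℂ)

/-- A line in `ℙ²`: the zero locus of a nonzero linear form. -/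
def IsLine (L : Set P2) : Prop :=
  ∃ a : Fin 3 → ℂ, a ≠ 0 ∧ L = {p : P2 | (∑ i, a i * p.rep i) = 0}

/-- An irreducible conic in `ℙ²`: the zero locus of an irreducible homogeneous quadratic form. -/
def IsIrredConic (γ : Set P2) : Prop :=
  ∃ q : MvPolynomial (Fin 3) ℂ, q.IsHomogeneous 2 ∧ Irreducible q ∧
    γ = {p : P2 | eval p.rep q = 0}

/-- `L` is tangent to `γ` : their intersection is a single point. -/
def IsTangent (L γ : Set P2) : Prop := ∃ p : P2, L ∩ γ = {p}

/-- The star configuration defined by a family of lines: the set of points lying on at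
least two of the lines. -/
def starConfig {r : ℕ} (L : Fin r → Set P2) : Set P2 :=
  {p : P2 | ∃ i j : Fin r, i ≠ j ∧ p ∈ L i ∧ p ∈ L j}

/-- A family of lines meets properly: they are distinct lines, no three concurrent. -/
def MeetsProperly {r : ℕ} (L : Fin r → Set P2) : Prop :=
  (∀ i, IsLine (L i)) ∧ Function.Injective L ∧
    ∀ (p : P2) (i j k : Fin r), p ∈ L i → p ∈ L j → p ∈ L k → i = j ∨ i = k ∨ j = k

/-- `W` is a complete intersection of type `(a,b)`. -/
def IsCI (W : Set P2) (a b : ℕ) : Prop :=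
  ∃ F G : MvPolynomial (Fin 3) ℂ, F ≠ 0 ∧ G ≠ 0 ∧
    F.IsHomogeneous a ∧ G.IsHomogeneous b ∧
    {p : P2 | eval p.rep F = 0 ∧ eval p.rep G = 0} = W ∧ W.ncard = a * b

/-- The `ℂ`-submodule of polynomials vanishing at every point of `W`. -/
def vanishingSubmodule (W : Set P2) : Submodule ℂ (MvPolynomial (Fin 3) ℂ) where
  carrier := {F : MvPolynomial (Fin 3) ℂ | ∀ p ∈ W, eval p.rep F = 0}
  add_mem' := by
    intro a b ha hb p hp
    simp only [map_add, ha p hp, hb p hp, add_zero]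
  zero_mem' := by
    intro p hp
    simp
  smul_mem' := by
    intro c F hF p hp
    simp only [smul_eval, hF p hp, mul_zero]

/-- The degree-`d` graded component of the vanishing ideal of `W`. -/
def idealComp (W : Set P2) (d : ℕ) : Submodule ℂ (MvPolynomial (Fin 3) ℂ) :=
  homogeneousSubmodule (Fin 3) ℂ d ⊓ vanishingSubmodule W

/-- The Hilbert function of `W ⊆ ℙ²`. -/
def HF (W : Set P2) (d : ℕ) : ℤ :=
  (Module.finrank ℂ ↥(homogeneousSubmodule (Fin 3) ℂ d) : ℤ) -
    (Module.finrank ℂ ↥(idealComp W d) : ℤ)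

/-- The h-vector of `W ⊆ ℙ²`. -/
def hvec (W : Set P2) : ℕ → ℤ
  | 0 => HF W 0
  | d + 1 => HF W (d + 1) - HF W d

/-- The (affine cone) ideal of a point of `ℙ²`; its powers cut out fat points. -/
def pointIdeal (p : P2) : Ideal (MvPolynomial (Fin 3) ℂ) := RingHom.ker (eval p.rep)

/-- The degree-`d` graded component of a homogeneous ideal `I`. -/
def idealCompI (I : Ideal (MvPolynomial (Fin 3) ℂ)) (d : ℕ) :
    Submodule ℂ (MvPolynomial (Fin 3) ℂ) :=
  homogeneousSubmodule (Fin 3) ℂ d ⊓ Submodule.restrictScalars ℂ I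

/-- The Hilbert function of `S/I`. -/
def HFI (I : Ideal (MvPolynomial (Fin 3) ℂ)) (d : ℕ) : ℤ :=
  (Module.finrank ℂ ↥(homogeneousSubmodule (Fin 3) ℂ d) : ℤ) -
    (Module.finrank ℂ ↥(idealCompI I d) : ℤ)

/-- The h-vector of `S/I`. -/
def hvecI (I : Ideal (MvPolynomial (Fin 3) ℂ)) : ℕ → ℤ
  | 0 => HFI I 0
  | d + 1 => HFI I (d + 1) - HFI I d

/-- The Hadamard-product relation: `R = P ⋆ Q`. -/
def hadRel (P Q R : P2) : Prop :=
  ∃ (u v : Fin 3 → ℂ) (hu : u ≠ 0) (hv : v ≠ 0) (huv : (fun i => u i * v i) ≠ 0),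
    Projectivization.mk ℂ u hu = P ∧ Projectivization.mk ℂ v hv = Q ∧
      Projectivization.mk ℂ (fun i => u i * v i) huv = R

/-- `Δ₀`: points of `ℙ²` with at most one nonzero coordinate. -/
def Δ₀ : Set P2 := {p : P2 | ∃ i : Fin 3, ∀ j : Fin 3, j ≠ i → p.rep j = 0}

/-- The polarisation of the Veronese parametrisation `s ↦ (s₀², 2 s₀ s₁, s₁²)` of the conic
`y² = 4 x z`. -/
def polarVeronese (s t : Fin 2 → ℂ) : Fin 3 → ℂ :=
  ![s 0 * t 0, s 0 * t 1 + s 1 * t 0, s 1 * t 1]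

/-- The determinant of two vectors of the plane. -/
def bracket (s t : Fin 2 → ℂ) : ℂ := s 0 * t 1 - s 1 * t 0

/-- A product of linear forms on the plane. -/
def linProd {r : ℕ} (c : Fin r → Fin 2 → ℂ) (s : Fin 2 → ℂ) : ℂ :=
  ∏ i, (c i 0 * s 0 + c i 1 * s 1)

lemma polarVeronese_comm (s t : Fin 2 → ℂ) : polarVeronese s t = polarVeronese t s := by
  ext i
  fin_cases i <;> simp [polarVeronese] <;> ring

lemma exists_polarVeronese_eq (v : Fin 3 → ℂ) : ∃ s t, polarVeronese s t = v := by
  by_cases h : v 0 = 0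
  · refine ⟨![0, 1], ![v 1, v 2], ?_⟩
    ext i
    fin_cases i <;> simp [polarVeronese, h]
  · obtain ⟨w, hw⟩ := IsAlgClosed.exists_eq_mul_self (v 1 ^ 2 - 4 * v 0 * v 2)
    refine ⟨![1, (v 1 + w) / (2 * v 0)], ![v 0, (v 1 - w) / 2], ?_⟩
    ext i
    fin_cases i
    · simp [polarVeronese]
    · simp [polarVeronese]
      field_simp
      ring
    · simp [polarVeronese]
      field_simp
      linear_combination hw

lemma exists_symmetric_pair (n : ℕ) (a b : Fin (n + 1) → Fin 2 → ℂ) :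
    ∃ M D : MvPolynomial (Fin 3) ℂ, M.IsHomogeneous (n + 1) ∧ D.IsHomogeneous n ∧
      (∀ s t, eval (polarVeronese s t) M =
        linProd a s * linProd b t + linProd a t * linProd b s) ∧
      ∀ s t, bracket s t * eval (polarVeronese s t) D =
        linProd a s * linProd b t - linProd a t * linProd b s := by
  have key : ∀ c d : Fin 2 → ℂ, ∃ m : MvPolynomial (Fin 3) ℂ, m.IsHomogeneous 1 ∧
      ∀ s t, eval (polarVeronese s t) m =
        (c 0 * s 0 + c 1 * s 1) * (d 0 * t 0 + d 1 * t 1) +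
        (c 0 * t 0 + c 1 * t 1) * (d 0 * s 0 + d 1 * s 1) := by
    intro c d
    refine ⟨C (2 * c 0 * d 0) * X 0 + C (c 0 * d 1 + c 1 * d 0) * X 1 + C (2 * c 1 * d 1) * X 2,
      ((isHomogeneous_C_mul_X _ _).add (isHomogeneous_C_mul_X _ _)).add
        (isHomogeneous_C_mul_X _ _), fun s t => ?_⟩
    simp [polarVeronese]
    ring
  induction n with
  | zero =>
    obtain ⟨m, hm, hm'⟩ := key (a 0) (b 0)
    refine ⟨m, C (bracket (a 0) (b 0)), hm, isHomogeneous_C _ _, fun s t => ?_, fun s t => ?_⟩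
    · simp [linProd, hm']
    · simp [linProd, bracket]
      ring
  | succ n ih =>
    obtain ⟨M, D, hM, hD, hM', hD'⟩ := ih (fun i => a i.succ) (fun i => b i.succ)
    obtain ⟨m, hm, hm'⟩ := key (a 0) (b 0)
    have hΔ : (X 1 ^ 2 - C 4 * (X 0 * X 2) : MvPolynomial (Fin 3) ℂ).IsHomogeneous 2 :=
      ((isHomogeneous_X _ _).pow 2).sub
        (((isHomogeneous_X _ _).mul (isHomogeneous_X _ _)).C_mul _)
    refine ⟨C (1 / 2) * (m * M + C (bracket (a 0) (b 0)) * ((X 1 ^ 2 - C 4 * (X 0 * X 2)) * D)),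
      C (1 / 2) * (C (bracket (a 0) (b 0)) * M + m * D), ?_, ?_, fun s t => ?_, fun s t => ?_⟩
    · refine IsHomogeneous.C_mul (IsHomogeneous.add ?_ (IsHomogeneous.C_mul ?_ _)) _
      · rw [show n + 1 + 1 = 1 + (n + 1) by ring]
        exact hm.mul hM
      · rw [show n + 1 + 1 = 2 + n by ring]
        exact hΔ.mul hD
    · refine IsHomogeneous.C_mul (IsHomogeneous.add (IsHomogeneous.C_mul hM _) ?_) _
      rw [add_comm n 1]
      exact hm.mul hD
    · have h1 := hM' s t
      have h2 := hD' s t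
      have h3 := hm' s t
      have h4 : eval (polarVeronese s t) (X 1 ^ 2 - C 4 * (X 0 * X 2)) = bracket s t ^ 2 := by
        simp [polarVeronese, bracket]
        ring
      have h5 : ∀ (c : Fin (n + 2) → Fin 2 → ℂ) s, linProd c s =
          (c 0 0 * s 0 + c 0 1 * s 1) * linProd (fun i => c i.succ) s := fun c s => by
        simp only [linProd, Fin.prod_univ_succ]
      simp only [map_mul, map_add, eval_C, h1, h3, h4, h5]
      have h6 : bracket (a 0) (b 0) * bracket s t =
        (a 0 0 * s 0 + a 0 1 * s 1) * (b 0 0 * t 0 + b 0 1 * t 1) -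
        (a 0 0 * t 0 + a 0 1 * t 1) * (b 0 0 * s 0 + b 0 1 * s 1) := by
        simp only [bracket]
        ring
      linear_combination (1 / 2) * bracket (a 0) (b 0) * bracket s t * h2 +
        (1 / 2) * h6 * (linProd (fun i => a i.succ) s * linProd (fun i => b i.succ) t -
          linProd (fun i => a i.succ) t * linProd (fun i => b i.succ) s)
    · have h1 := hM' s t
      have h2 := hD' s t
      have h3 := hm' s t
      have h5 : ∀ (c : Fin (n + 2) → Fin 2 → ℂ) s, linProd c s =
          (c 0 0 * s 0 + c 0 1 * s 1) * linProd (fun i => c i.succ) s := fun c s => by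
        simp only [linProd, Fin.prod_univ_succ]
      simp only [map_mul, map_add, eval_C, h1, h3, h5]
      have h6 : bracket (a 0) (b 0) * bracket s t =
        (a 0 0 * s 0 + a 0 1 * s 1) * (b 0 0 * t 0 + b 0 1 * t 1) -
        (a 0 0 * t 0 + a 0 1 * t 1) * (b 0 0 * s 0 + b 0 1 * s 1) := by
        simp only [bracket]
        ring
      linear_combination (1 / 2) * h2 * (
        (a 0 0 * s 0 + a 0 1 * s 1) * (b 0 0 * t 0 + b 0 1 * t 1) +
        (a 0 0 * t 0 + a 0 1 * t 1) * (b 0 0 * s 0 + b 0 1 * s 1)) +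
        (1 / 2) * h6 * (linProd (fun i => a i.succ) s * linProd (fun i => b i.succ) t +
          linProd (fun i => a i.succ) t * linProd (fun i => b i.succ) s)

lemma exists_eval_eq_zero_of_not_isUnit {G : MvPolynomial (Fin 3) ℂ} (hG : ¬ IsUnit G) :
    ∃ w, eval w G = 0 := by
  obtain ⟨I, hI, hGI⟩ := Ideal.exists_le_maximal (Ideal.span {G})
    (by rwa [Ne, Ideal.span_singleton_eq_top])
  obtain ⟨x, rfl⟩ := (isMaximal_iff_eq_vanishingIdeal_singleton).1 hI
  refine ⟨x, ?_⟩
  have := hGI (Ideal.mem_span_singleton_self G)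
  rw [mem_vanishingIdeal_singleton_iff] at this
  simpa [aeval_eq_eval] using this

lemma three_le_height_vanishingIdeal_zero :
    3 ≤ (vanishingIdeal ℂ {(0 : Fin 3 → ℂ)}).height := by
  let φ (k : ℕ) : MvPolynomial (Fin 3) ℂ →ₐ[ℂ] MvPolynomial (Fin 3) ℂ :=
    aeval fun i => if i.val < k then 0 else X i
  have hφ : ∀ k ≤ 2, RingHom.ker (φ k) < RingHom.ker (φ (k + 1)) := by
    intro k hk
    refine SetLike.lt_iff_le_and_exists.2 ⟨fun p hp => ?_, X ⟨k, by omega⟩, ?_, ?_⟩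
    · have : (φ (k + 1)) = (φ (k + 1)).comp (φ k) := by
        ext i : 1
        by_cases h : i.val < k
        · simp [φ, h, h.le]
        · simp only [φ, AlgHom.comp_apply, aeval_X, if_neg h]
      rw [RingHom.mem_ker] at hp ⊢
      rw [this, AlgHom.comp_apply, hp, map_zero]
    · simp [φ]
    · simp [φ]
  have : ∀ k, (RingHom.ker (φ k)).IsPrime := fun k => RingHom.ker_isPrime _
  have h (k) (hk : k ≤ 2) := Ideal.height_add_one_le_of_lt_of_isPrime (hφ k hk)
  have h3 : RingHom.ker (φ 3) ≤ vanishingIdeal ℂ {(0 : Fin 3 → ℂ)} := by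
    intro p hp
    rw [mem_vanishingIdeal_singleton_iff]
    have : (aeval (0 : Fin 3 → ℂ) : MvPolynomial (Fin 3) ℂ →ₐ[ℂ] ℂ) =
        (aeval (0 : Fin 3 → ℂ)).comp (φ 3) := by
      ext i
      simp [φ]
    rw [RingHom.mem_ker] at hp
    rw [this, AlgHom.comp_apply, hp, map_zero]
  calc (3 : ℕ∞) = 0 + 1 + 1 + 1 := by norm_num
    _ ≤ (RingHom.ker (φ 0)).height + 1 + 1 + 1 := by gcongr; exact zero_le
    _ ≤ (RingHom.ker (φ 1)).height + 1 + 1 := by gcongr; exact h 0 (by norm_num)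
    _ ≤ (RingHom.ker (φ 2)).height + 1 := by gcongr; exact h 1 (by norm_num)
    _ ≤ (RingHom.ker (φ 3)).height := h 2 (by norm_num)
    _ ≤ _ := Ideal.height_mono h3

lemma exists_ne_zero_common_zero {G H : MvPolynomial (Fin 3) ℂ}
    (hG : eval 0 G = 0) (hH : eval 0 H = 0) : ∃ w ≠ 0, eval w G = 0 ∧ eval w H = 0 := by
  classical
  by_contra! hcon
  have hmin : vanishingIdeal ℂ {(0 : Fin 3 → ℂ)} ∈
      (Ideal.span (({G, H} : Finset (MvPolynomial (Fin 3) ℂ)) : Set _)).minimalPrimes := by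
    refine ⟨⟨inferInstance, Ideal.span_le.2 ?_⟩, fun J hJ _ => ?_⟩
    · intro p hp
      simp only [Finset.coe_insert, Finset.coe_singleton, Set.mem_insert_iff,
        Set.mem_singleton_iff] at hp
      rw [SetLike.mem_coe, mem_vanishingIdeal_singleton_iff]
      rw [aeval_eq_eval]
      rcases hp with rfl | rfl
      · exact hG
      · exact hH
    · refine le_trans ?_ (hJ.1.radical_le_iff.2 hJ.2)
      rw [← vanishingIdeal_zeroLocus_eq_radical (K := ℂ)]
      refine vanishingIdeal_anti_mono fun w hw => ?_
      by_contra hw0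
      exact hcon w hw0 (by simpa [aeval_eq_eval] using hw G (Ideal.subset_span (by simp)))
        (by simpa [aeval_eq_eval] using hw H (Ideal.subset_span (by simp)))
  have h1 := Ideal.height_le_card_of_mem_minimalPrimes_span_finset hmin
  have h2 : ((({G, H} : Finset (MvPolynomial (Fin 3) ℂ)).card : ℕ) : ℕ∞) ≤ 2 := by
    exact_mod_cast Finset.card_le_two
  exact absurd (three_le_height_vanishingIdeal_zero.trans (h1.trans h2)) (by norm_num)

lemma eval_smul_of_isHomogeneous {F : MvPolynomial (Fin 3) ℂ} {r : ℕ} (hF : F.IsHomogeneous r)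
    (c : ℂ) (v : Fin 3 → ℂ) : eval (c • v) F = c ^ r * eval v F := by
  rw [eval_eq, eval_eq, Finset.mul_sum]
  refine Finset.sum_congr rfl fun d hd => ?_
  have : c ^ r = ∏ i ∈ d.support, c ^ d i := by
    rw [Finset.prod_pow_eq_pow_sum, hF.degree_eq_sum_deg_support hd]
  simp only [Pi.smul_apply, smul_eq_mul, mul_pow, Finset.prod_mul_distrib, this]
  ring

lemma common_zero_of_mul_isHomogeneous {G H : MvPolynomial (Fin 3) ℂ} {r : ℕ}
    (hF : (G * H).IsHomogeneous r) (hG : ¬ IsUnit G) (hH : ¬ IsUnit H) :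
    ∃ w ≠ 0, eval w G = 0 ∧ eval w H = 0 := by
  have aux : ∀ G H : MvPolynomial (Fin 3) ℂ, (G * H).IsHomogeneous r → ¬ IsUnit G →
      eval 0 G ≠ 0 → ∃ w ≠ 0, eval w G = 0 ∧ eval w H = 0 := by
    intro G H hF hG hG0
    obtain ⟨w, hw⟩ := exists_eval_eq_zero_of_not_isUnit hG
    let ψ : MvPolynomial (Fin 3) ℂ →ₐ[ℂ] Polynomial ℂ :=
      aeval fun i => Polynomial.C (w i) * Polynomial.X
    have hψ : ∀ (P : MvPolynomial (Fin 3) ℂ) (c : ℂ), (ψ P).eval c = eval (c • w) P := by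
      intro P c
      induction P using MvPolynomial.induction_on with
      | C a => simp [ψ]
      | add p q hp hq => simp [hp, hq]
      | mul_X p i hp => simp [hp, ψ]; left; ring
    have h0 : ψ G * ψ H = 0 := by
      rw [← map_mul]
      refine Polynomial.funext fun c => ?_
      rw [hψ, eval_smul_of_isHomogeneous hF, map_mul, hw]
      simp
    refine ⟨w, ?_, hw, ?_⟩
    · rintro rfl
      exact hG0 hw
    · rcases mul_eq_zero.1 h0 with h | h
      · refine absurd ?_ hG0
        simpa [h] using (hψ G 0).symm
      · simpa [h] using (hψ H 1).symm
  by_cases hG0 : eval 0 G = 0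
  · by_cases hH0 : eval 0 H = 0
    · exact exists_ne_zero_common_zero hG0 hH0
    · obtain ⟨w, hw, h1, h2⟩ := aux H G (mul_comm G H ▸ hF) hH hH0
      exact ⟨w, hw, h2, h1⟩
  · exact aux G H hF hG hG0

lemma irreducible_of_smooth {F : MvPolynomial (Fin 3) ℂ} {r : ℕ} (hr : r ≠ 0)
    (hF : F.IsHomogeneous r)
    (hsm : ∀ v ≠ 0, eval v F = 0 → ∃ i, eval v (pderiv i F) ≠ 0) : Irreducible F := by
  refine ⟨fun hu => ?_, fun G H hGH => ?_⟩
  · have h := eval_smul_of_isHomogeneous hF 0 0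
    rw [zero_pow hr, zero_mul, zero_smul] at h
    exact (hu.map (eval 0)).ne_zero h
  · by_contra! hcon
    subst hGH
    obtain ⟨w, hw, h1, h2⟩ := common_zero_of_mul_isHomogeneous hF hcon.1 hcon.2
    obtain ⟨i, hi⟩ := hsm w hw (by simp [h1])
    exact hi (by simp [Derivation.leibniz, h1, h2])

/-- The linear form `∑ ℓᵢ Xᵢ`. -/
def linForm (c : Fin 3 → ℂ) : MvPolynomial (Fin 3) ℂ := ∑ i, C (c i) * X i

lemma isHomogeneous_linForm (c : Fin 3 → ℂ) : (linForm c).IsHomogeneous 1 :=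
  IsHomogeneous.sum _ _ _ fun i _ => isHomogeneous_C_mul_X _ i

lemma pderiv_linForm (c : Fin 3 → ℂ) (i : Fin 3) : pderiv i (linForm c) = C (c i) := by
  simp only [linForm, map_sum, pderiv_C_mul, pderiv_X, Pi.single_apply, mul_ite, mul_one,
    mul_zero, Finset.sum_ite_eq', Finset.mem_univ, if_true]

lemma exists_aeval_eq_zero (N : Option (Fin 3) → MvPolynomial (Fin 3) ℂ) :
    ∃ P : MvPolynomial (Option (Fin 3)) ℂ, P ≠ 0 ∧ aeval N P = 0 := by
  by_contra! hcon
  have hind : AlgebraicIndependent ℂ N :=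
    (injective_iff_map_eq_zero _).2 fun P hP => by
      by_contra h
      exact hcon P h hP
  have h := hind.cardinalMk_le_trdeg
  rw [MvPolynomial.trdeg_of_isDomain] at h
  simp only [Cardinal.mk_fintype, Fintype.card_option, Fintype.card_fin, Cardinal.lift_natCast,
    Nat.cast_le] at h
  omega

lemma exists_linForm_smooth_off {n : ℕ} (hn : n ≠ 0) {M D : MvPolynomial (Fin 3) ℂ}
    (hM : M.IsHomogeneous (n + 1)) (hD : D.IsHomogeneous n) :
    ∃ c : Fin 3 → ℂ, ∀ v, eval v D ≠ 0 → eval v (M + linForm c * D) = 0 →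
      ∃ i, eval v (pderiv i (M + linForm c * D)) ≠ 0 := by
  let N : Option (Fin 3) → MvPolynomial (Fin 3) ℂ :=
    fun o => o.elim (D * D) fun i => M * pderiv i D - D * pderiv i M
  have hN : ∀ o, (N o).IsHomogeneous (2 * n) := by
    rintro (_ | i)
    · rw [two_mul]
      exact hD.mul hD
    · refine IsHomogeneous.sub ?_ ?_
      · rw [show 2 * n = n + 1 + (n - 1) by omega]
        exact hM.mul hD.pderiv
      · rw [show 2 * n = n + (n + 1 - 1) by omega]
        exact hD.mul hM.pderiv
  obtain ⟨P, hP0, hP⟩ := exists_aeval_eq_zero N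
  have hPN : ∀ v, eval (fun o => eval v (N o)) P = 0 := by
    intro v
    have := congrArg (eval v) hP
    rw [map_zero] at this
    rw [← this, ← coe_aeval_eq_eval, ← coe_aeval_eq_eval]
    simp only [RingHom.coe_coe]
    rw [← AlgHom.comp_apply, comp_aeval]
  obtain ⟨x, hx⟩ : ∃ x, eval x (P * X none) ≠ 0 := by
    by_contra! h
    exact mul_ne_zero hP0 (X_ne_zero none) (MvPolynomial.funext fun x => by simpa using h x)
  rw [map_mul, eval_X, mul_ne_zero_iff] at hx
  refine ⟨fun i => x (some i) / x none, fun v hv hF => ?_⟩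
  by_contra! hcon
  obtain ⟨μ, hμ⟩ := IsAlgClosed.exists_pow_nat_eq (x none / eval v D ^ 2)
    (show 0 < 2 * n by omega)
  refine hx.1 ?_
  rw [← hPN (μ • v)]
  congr 2
  ext o
  rw [eval_smul_of_isHomogeneous (hN o), hμ]
  rcases o with _ | i
  · simp [N]
    field_simp
  · have h1 := hcon i
    simp only [map_add, map_mul, Derivation.leibniz, smul_eq_mul, pderiv_linForm, eval_C] at h1 hF
    have h2 : eval v (N (some i)) = x (some i) / x none * eval v D ^ 2 := by
      simp only [N, Option.elim, map_sub, map_mul]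
      linear_combination eval v (pderiv i D) * hF - eval v D * h1
    rw [h2]
    have := hx.2
    field_simp

lemma hasDerivAt_eval_line (P : MvPolynomial (Fin 3) ℂ) (v u : Fin 3 → ℂ) :
    HasDerivAt (fun ε : ℂ => eval (v + ε • u) P) (∑ i, u i * eval v (pderiv i P)) 0 := by
  induction P using MvPolynomial.induction_on with
  | C a => simpa using hasDerivAt_const (0 : ℂ) a
  | add p q hp hq => simpa [mul_add, Finset.sum_add_distrib] using hp.fun_add hq
  | mul_X p j hp =>
    have h : HasDerivAt (fun ε : ℂ => v j + ε * u j) (u j) 0 := by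
      simpa using ((hasDerivAt_id (0 : ℂ)).mul_const (u j)).const_add (v j)
    have h2 := hp.mul h
    simp only [zero_smul, add_zero, zero_mul] at h2
    convert! h2 using 1
    · ext ε
      simp
    · simp only [Derivation.leibniz, smul_eq_mul, map_add, map_mul, eval_X, pderiv_X, mul_add,
        Finset.sum_add_distrib, Finset.sum_mul]
      rw [add_comm]
      congr 1
      · exact Finset.sum_congr rfl fun i _ => by ring
      · rw [Finset.sum_eq_single j]
        · simp
          ring
        · intro i _ hi
          simp [hi.symm]
        · simp

lemma eq_zero_of_bracket_ne_zero {c d s : Fin 2 → ℂ} (h : bracket c d ≠ 0)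
    (hc : c 0 * s 0 + c 1 * s 1 = 0) (hd : d 0 * s 0 + d 1 * s 1 = 0) : s = 0 := by
  have e0 : bracket c d * s 0 = 0 := by
    unfold bracket
    linear_combination d 1 * hc - c 1 * hd
  have e1 : bracket c d * s 1 = 0 := by
    unfold bracket
    linear_combination c 0 * hd - d 0 * hc
  ext k
  fin_cases k
  · simpa [h] using e0
  · simpa [h] using e1

lemma exists_hasDerivAt_linProd {r : ℕ} {c : Fin r → Fin 2 → ℂ} (hc0 : ∀ i, c i ≠ 0)
    (hc : ∀ i j, i ≠ j → bracket (c i) (c j) ≠ 0) {s : Fin 2 → ℂ} (hs : s ≠ 0)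
    (h : linProd c s = 0) :
    ∃ (s' : Fin 2 → ℂ) (d : ℂ), d ≠ 0 ∧
      HasDerivAt (fun ε : ℂ => linProd c (s + ε • s')) d 0 := by
  obtain ⟨i, -, hi⟩ := Finset.prod_eq_zero_iff.1 h
  obtain ⟨s', hs'⟩ : ∃ s' : Fin 2 → ℂ, c i 0 * s' 0 + c i 1 * s' 1 ≠ 0 := by
    by_contra! hcon
    refine hc0 i ?_
    ext k
    fin_cases k
    · simpa using hcon ![1, 0]
    · simpa using hcon ![0, 1]
  let g : ℂ → ℂ := fun ε => ∏ j ∈ Finset.univ.erase i,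
    (c j 0 * (s 0 + ε * s' 0) + c j 1 * (s 1 + ε * s' 1))
  have hg : DifferentiableAt ℂ g 0 := by
    unfold g
    fun_prop
  have hg0 : g 0 ≠ 0 := by
    refine Finset.prod_ne_zero_iff.2 fun j hj h0 => ?_
    simp only [zero_mul, add_zero] at h0
    have hij := hc i j (Finset.ne_of_mem_erase hj).symm
    exact hs (eq_zero_of_bracket_ne_zero hij hi h0)
  refine ⟨s', (c i 0 * s' 0 + c i 1 * s' 1) * g 0, mul_ne_zero hs' hg0, ?_⟩
  have h1 : HasDerivAt (fun ε : ℂ => ε * (c i 0 * s' 0 + c i 1 * s' 1))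
      (c i 0 * s' 0 + c i 1 * s' 1) 0 := by
    simpa using (hasDerivAt_id (0 : ℂ)).mul_const (c i 0 * s' 0 + c i 1 * s' 1)
  have h2 := h1.mul hg.hasDerivAt
  simp only [zero_mul, add_zero] at h2
  convert! h2 using 1
  ext ε
  simp only [linProd, Pi.mul_apply, g]
  rw [← Finset.mul_prod_erase _ _ (Finset.mem_univ i)]
  simp only [Pi.add_apply, Pi.smul_apply, smul_eq_mul]
  congr 1
  linear_combination hi

lemma bracket_eq_of_grad_eq_zero {M D : MvPolynomial (Fin 3) ℂ} {A B : (Fin 2 → ℂ) → ℂ}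
    (hM : ∀ s t, eval (polarVeronese s t) M = A s * B t + A t * B s)
    (hD : ∀ s t, bracket s t * eval (polarVeronese s t) D = A s * B t - A t * B s)
    {s t s' : Fin 2 → ℂ} {d l : ℂ} (ht : A t = 0) (hBt : B t ≠ 0) (hd : d ≠ 0)
    (hA : HasDerivAt (fun ε : ℂ => A (s + ε • s')) d 0) (hDv : eval (polarVeronese s t) D = 0)
    (hgrad : ∀ i, eval (polarVeronese s t) (pderiv i M) +
      l * eval (polarVeronese s t) (pderiv i D) = 0) :
    bracket s t ≠ 0 ∧ bracket s t + l = 0 := by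
  have hline : ∀ ε : ℂ, polarVeronese (s + ε • s') t =
      polarVeronese s t + ε • polarVeronese s' t := by
    intro ε
    ext i
    fin_cases i <;> simp [polarVeronese] <;> ring
  have hAB := hA.mul_const (B t)
  have h1 := hasDerivAt_eval_line M (polarVeronese s t) (polarVeronese s' t)
  have h2 := hasDerivAt_eval_line D (polarVeronese s t) (polarVeronese s' t)
  simp only [← hline] at h1 h2
  have h3 : HasDerivAt (fun ε : ℂ => bracket (s + ε • s') t) (bracket s' t) 0 := by
    have : (fun ε : ℂ => bracket (s + ε • s') t) = fun ε => bracket s t + ε * bracket s' t := by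
      ext ε
      simp only [bracket, Pi.add_apply, Pi.smul_apply, smul_eq_mul]
      ring
    rw [this]
    simpa using ((hasDerivAt_id (0 : ℂ)).mul_const (bracket s' t)).const_add (bracket s t)
  have h4 := h3.mul h2
  have e4 : ((fun ε : ℂ => bracket (s + ε • s') t) *
      fun ε : ℂ => eval (polarVeronese (s + ε • s') t) D) =
      fun ε => A (s + ε • s') * B t := by
    ext ε
    simp [hD, ht]
  have e1 : (fun ε : ℂ => eval (polarVeronese (s + ε • s') t) M) =
      fun ε => A (s + ε • s') * B t := by
    ext ε
    simp [hM, ht]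
  rw [e4] at h4
  rw [e1] at h1
  have u1 := h1.unique hAB
  have u4 := h4.unique hAB
  simp only [zero_smul, add_zero, hDv, mul_zero, zero_add] at u4
  have hdB := mul_ne_zero hd hBt
  have hsum : ∑ i, polarVeronese s' t i * eval (polarVeronese s t) (pderiv i M) +
      l * ∑ i, polarVeronese s' t i * eval (polarVeronese s t) (pderiv i D) = 0 := by
    rw [Finset.mul_sum, ← Finset.sum_add_distrib]
    refine Finset.sum_eq_zero fun i _ => ?_
    linear_combination polarVeronese s' t i * hgrad i
  refine ⟨fun h => hdB ?_, (mul_eq_zero.1 ?_).resolve_right hdB⟩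
  · rw [← u4, h, zero_mul]
  · linear_combination bracket s t * hsum - bracket s t * u1 - l * u4

/-- The value at `v` of the linear form defining the tangent line of the conic `y² = 4 x z` with
dual coordinates `c`. -/
def tangentForm (c : Fin 2 → ℂ) (v : Fin 3 → ℂ) : ℂ :=
  c 0 ^ 2 * v 0 + c 0 * c 1 * v 1 + c 1 ^ 2 * v 2

lemma tangentForm_polarVeronese (c s t : Fin 2 → ℂ) :
    tangentForm c (polarVeronese s t) =
      (c 0 * s 0 + c 1 * s 1) * (c 0 * t 0 + c 1 * t 1) := by
  simp [tangentForm, polarVeronese]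
  ring

lemma linProd_eq_zero_of_bracket_ne_zero {r k : ℕ} {a : Fin r → Fin 2 → ℂ}
    {b : Fin k → Fin 2 → ℂ} (hab : ∀ i j, bracket (a i) (b j) ≠ 0) {s : Fin 2 → ℂ} (hs : s ≠ 0)
    (ha : linProd a s = 0) : linProd b s ≠ 0 := by
  intro hb
  obtain ⟨i, -, hi⟩ := Finset.prod_eq_zero_iff.1 ha
  obtain ⟨j, -, hj⟩ := Finset.prod_eq_zero_iff.1 hb
  exact hs (eq_zero_of_bracket_ne_zero (hab i j) hi hj)

lemma linProd_eq_zero_of_tangentForm {r : ℕ} {c : Fin r → Fin 2 → ℂ}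
    (hc : ∀ i j, i ≠ j → bracket (c i) (c j) ≠ 0) {i j : Fin r} (hij : i ≠ j) {s t : Fin 2 → ℂ}
    (hs : s ≠ 0) (ht : t ≠ 0) (hi : tangentForm (c i) (polarVeronese s t) = 0)
    (hj : tangentForm (c j) (polarVeronese s t) = 0) :
    linProd c s = 0 ∧ linProd c t = 0 ∧ bracket s t ≠ 0 := by
  have zero : ∀ {s : Fin 2 → ℂ} (i), c i 0 * s 0 + c i 1 * s 1 = 0 → linProd c s = 0 :=
    fun i h => Finset.prod_eq_zero (Finset.mem_univ i) h
  have key : ∀ i j, i ≠ j → c i 0 * s 0 + c i 1 * s 1 = 0 → c j 0 * t 0 + c j 1 * t 1 = 0 →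
      bracket s t ≠ 0 := by
    intro i j hij h1 h2 h0
    have e0 : bracket (c i) (c j) * (s 0 * t 0) = 0 := by
      unfold bracket at *
      linear_combination c j 1 * t 0 * h1 - c i 1 * s 0 * h2 + c i 1 * c j 1 * h0
    have e1 : bracket (c i) (c j) * (s 1 * t 1) = 0 := by
      unfold bracket at *
      linear_combination c i 0 * s 1 * h2 - c j 0 * t 1 * h1 + c i 0 * c j 0 * h0
    have e2 : bracket (c i) (c j) * (s 0 * t 1) = 0 := by
      unfold bracket at *
      linear_combination c j 1 * t 1 * h1 - c i 1 * s 1 * h2 - c i 1 * c j 0 * h0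
    have e3 : bracket (c i) (c j) * (s 1 * t 0) = 0 := by
      have := (mul_eq_zero.1 e2).resolve_left (hc i j hij)
      unfold bracket at *
      linear_combination (c i 0 * c j 1 - c i 1 * c j 0) * (this - h0)
    simp only [mul_eq_zero, hc i j hij, false_or] at e0 e1 e2 e3
    by_cases hs0 : s 0 = 0
    · have hs1 : s 1 ≠ 0 := fun hs1 => hs (by ext k; fin_cases k <;> simp [hs0, hs1])
      exact ht (by ext k; fin_cases k <;> simp [e3.resolve_left hs1, e1.resolve_left hs1])
    · exact ht (by ext k; fin_cases k <;> simp [e0.resolve_left hs0, e2.resolve_left hs0])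
  rw [tangentForm_polarVeronese, mul_eq_zero] at hi hj
  rcases hi with hi | hi <;> rcases hj with hj | hj
  · exact absurd (eq_zero_of_bracket_ne_zero (hc i j hij) hi hj) hs
  · exact ⟨zero i hi, zero j hj, key i j hij hi hj⟩
  · exact ⟨zero j hj, zero i hi, key j i hij.symm hj hi⟩
  · exact absurd (eq_zero_of_bracket_ne_zero (hc i j hij) hi hj) ht

theorem exists_irreducible_form_of_tangentForms {n : ℕ} (hn : n ≠ 0)
    {a b : Fin (n + 1) → Fin 2 → ℂ} (ha0 : ∀ i, a i ≠ 0) (hb0 : ∀ i, b i ≠ 0)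
    (ha : ∀ i j, i ≠ j → bracket (a i) (a j) ≠ 0)
    (hb : ∀ i j, i ≠ j → bracket (b i) (b j) ≠ 0)
    (hab : ∀ i j, bracket (a i) (b j) ≠ 0) :
    ∃ F : MvPolynomial (Fin 3) ℂ, F.IsHomogeneous (n + 1) ∧ Irreducible F ∧
      ∀ v ≠ 0, ((∃ i j, i ≠ j ∧ tangentForm (a i) v = 0 ∧ tangentForm (a j) v = 0) ∨
        ∃ i j, i ≠ j ∧ tangentForm (b i) v = 0 ∧ tangentForm (b j) v = 0) → eval v F = 0 := by
  obtain ⟨M, D, hM, hD, hMe, hDe⟩ := exists_symmetric_pair n a b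
  obtain ⟨c, hc⟩ := exists_linForm_smooth_off hn hM hD
  have hF : (M + linForm c * D).IsHomogeneous (n + 1) := by
    refine hM.add ?_
    rw [add_comm n 1]
    exact (isHomogeneous_linForm c).mul hD
  have ne_zero : ∀ {s t : Fin 2 → ℂ}, polarVeronese s t ≠ 0 → s ≠ 0 ∧ t ≠ 0 := by
    intro s t h
    constructor <;> rintro rfl <;> refine h ?_ <;> ext i <;> fin_cases i <;> simp [polarVeronese]
  have hba : ∀ i j, bracket (b i) (a j) ≠ 0 := fun i j h => hab j i (by
    unfold bracket at *
    linear_combination -h)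
  refine ⟨M + linForm c * D, hF, irreducible_of_smooth n.succ_ne_zero hF ?_, ?_⟩
  · intro v hv hFv
    by_cases hDv : eval v D = 0
    swap
    · exact hc v hDv hFv
    by_contra! hcon
    obtain ⟨s, t, rfl⟩ := exists_polarVeronese_eq v
    obtain ⟨hs, ht⟩ := ne_zero hv
    have hMv : eval (polarVeronese s t) M = 0 := by simpa [hDv] using hFv
    have hgrad : ∀ i, eval (polarVeronese s t) (pderiv i M) +
        eval (polarVeronese s t) (linForm c) * eval (polarVeronese s t) (pderiv i D) = 0 := by
      intro i
      simpa [Derivation.leibniz, hDv] using hcon i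
    have h1 := hMe s t
    have h2 := hDe s t
    rw [hMv] at h1
    rw [hDv, mul_zero] at h2
    have h3 : linProd a s * linProd b t = 0 := by linear_combination -(h1 + h2) / 2
    have h4 : linProd a t * linProd b s = 0 := by linear_combination -(h1 - h2) / 2
    have key : ∀ {M D : MvPolynomial (Fin 3) ℂ} {a b : Fin (n + 1) → Fin 2 → ℂ} {l : ℂ},
        (∀ i, a i ≠ 0) → (∀ i j, i ≠ j → bracket (a i) (a j) ≠ 0) →
        (∀ s t, eval (polarVeronese s t) M =
          linProd a s * linProd b t + linProd a t * linProd b s) →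
        (∀ s t, bracket s t * eval (polarVeronese s t) D =
          linProd a s * linProd b t - linProd a t * linProd b s) →
        linProd a s = 0 → linProd a t = 0 → linProd b s ≠ 0 → linProd b t ≠ 0 →
        eval (polarVeronese s t) D = 0 →
        (∀ i, eval (polarVeronese s t) (pderiv i M) +
          l * eval (polarVeronese s t) (pderiv i D) = 0) → False := by
      intro M D a b l ha0 ha hM hD has hat hbs hbt hDv hgrad
      obtain ⟨s', d, hd, hA⟩ := exists_hasDerivAt_linProd ha0 ha hs has
      obtain ⟨t', d', hd', hA'⟩ := exists_hasDerivAt_linProd ha0 ha ht hat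
      obtain ⟨h5, h6⟩ := bracket_eq_of_grad_eq_zero hM hD hat hbt hd hA hDv hgrad
      rw [polarVeronese_comm s t] at hDv hgrad
      obtain ⟨-, h7⟩ := bracket_eq_of_grad_eq_zero hM hD has hbs hd' hA' hDv hgrad
      refine h5 ?_
      unfold bracket at *
      linear_combination (h6 - h7) / 2
    rcases mul_eq_zero.1 h3 with h | h
    · have hbs := linProd_eq_zero_of_bracket_ne_zero hab hs h
      have hat := (mul_eq_zero.1 h4).resolve_right hbs
      exact key ha0 ha hMe hDe h hat hbs (linProd_eq_zero_of_bracket_ne_zero hab ht hat) hDv hgrad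
    · have hat := linProd_eq_zero_of_bracket_ne_zero hba ht h
      have hbs := (mul_eq_zero.1 h4).resolve_left hat
      refine key (M := M) (D := -D) (l := -eval (polarVeronese s t) (linForm c)) hb0 hb ?_ ?_ hbs h
        (linProd_eq_zero_of_bracket_ne_zero hba hs hbs) hat (by simpa using hDv)
        (by simpa using hgrad)
      · intro s t
        rw [hMe]
        ring
      · intro s t
        rw [map_neg, mul_neg, hDe]
        ring
  · intro v hv h
    obtain ⟨s, t, rfl⟩ := exists_polarVeronese_eq v
    obtain ⟨hs, ht⟩ := ne_zero hv
    have h1 := hMe s t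
    have h2 := hDe s t
    rcases h with ⟨i, j, hij, hi, hj⟩ | ⟨i, j, hij, hi, hj⟩
    · obtain ⟨h3, h4, h5⟩ := linProd_eq_zero_of_tangentForm ha hij hs ht hi hj
      simp only [h3, h4, zero_mul, sub_zero, add_zero, mul_eq_zero, h5, false_or] at h1 h2
      simp [h1, h2]
    · obtain ⟨h3, h4, h5⟩ := linProd_eq_zero_of_tangentForm hb hij hs ht hi hj
      simp only [h3, h4, mul_zero, sub_zero, add_zero, mul_eq_zero, h5, false_or] at h1 h2
      simp [h1, h2]

lemma exists_algEquiv_of_linearEquiv (T : (Fin 3 → ℂ) ≃ₗ[ℂ] (Fin 3 → ℂ)) :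
    ∃ φ : MvPolynomial (Fin 3) ℂ ≃ₐ[ℂ] MvPolynomial (Fin 3) ℂ,
      (∀ v P, eval v (φ P) = eval (T v) P) ∧
        ∀ P r, P.IsHomogeneous r → (φ P).IsHomogeneous r := by
  let f (T : (Fin 3 → ℂ) ≃ₗ[ℂ] (Fin 3 → ℂ)) :
      MvPolynomial (Fin 3) ℂ →ₐ[ℂ] MvPolynomial (Fin 3) ℂ :=
    aeval fun i => linForm fun j => T (Pi.single j 1) i
  have hf : ∀ T v P, eval v (f T P) = eval (T v) P := by
    intro T v P
    have hT : ∀ i, T v i = ∑ j, T (Pi.single j 1) i * v j := by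
      intro i
      conv_lhs => rw [pi_eq_sum_univ' v]
      simp [Finset.sum_apply, mul_comm]
    induction P using MvPolynomial.induction_on with
    | C a => simp [f]
    | add p q hp hq => simp [hp, hq]
    | mul_X p i hp =>
      rw [map_mul, map_mul, hp, map_mul, eval_X, hT]
      simp [f, linForm]
  refine ⟨AlgEquiv.ofAlgHom (f T) (f T.symm) ?_ ?_, hf T, fun P r hP => ?_⟩
  · refine AlgHom.ext fun P => MvPolynomial.funext fun v => ?_
    simp [hf]
  · refine AlgHom.ext fun P => MvPolynomial.funext fun v => ?_
    simp [hf]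
  · rw [← one_mul r]
    exact hP.aeval _ fun i => isHomogeneous_linForm fun j => T (Pi.single j 1) i

lemma exists_quadraticForm_eq_eval {q : MvPolynomial (Fin 3) ℂ} (hq : q.IsHomogeneous 2) :
    ∃ Q : QuadraticForm ℂ (Fin 3 → ℂ), ∀ v, Q v = eval v q := by
  have hmem : q ∈ homogeneousSubmodule (Fin 3) ℂ 1 * homogeneousSubmodule (Fin 3) ℂ 1 := by
    rw [← pow_two, homogeneousSubmodule_one_pow]
    exact hq
  rw [homogeneousSubmodule_one_eq_span_X, Submodule.span_mul_span] at hmem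
  clear hq
  induction hmem using Submodule.span_induction with
  | mem x hx =>
    obtain ⟨_, ⟨i, rfl⟩, _, ⟨j, rfl⟩, rfl⟩ := hx
    exact ⟨QuadraticMap.linMulLin (LinearMap.proj i) (LinearMap.proj j), fun v => by simp⟩
  | zero => exact ⟨0, by simp⟩
  | add x y _ _ hx hy =>
    obtain ⟨Q, hQ⟩ := hx
    obtain ⟨R, hR⟩ := hy
    exact ⟨Q + R, fun v => by simp [hQ, hR]⟩
  | smul c x _ hx =>
    obtain ⟨Q, hQ⟩ := hx
    exact ⟨c • Q, fun v => by simp [hQ]⟩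

lemma not_irreducible_sq_add_sq (a b : ℂ) (i j : Fin 3) :
    ¬ Irreducible (C a * X i ^ 2 + C b * X j ^ 2 : MvPolynomial (Fin 3) ℂ) := by
  obtain ⟨u, rfl⟩ := IsAlgClosed.exists_eq_mul_self a
  obtain ⟨w, hw⟩ := IsAlgClosed.exists_eq_mul_self (-b)
  have hfac : (C (u * u) * X i ^ 2 + C b * X j ^ 2 : MvPolynomial (Fin 3) ℂ) =
      (C u * X i + C w * X j) * (C u * X i - C w * X j) := by
    rw [← neg_neg b, hw]
    simp only [map_mul, map_neg]
    ring
  rw [hfac]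
  intro h
  rcases h.isUnit_or_isUnit rfl with h | h
  · exact (h.map (eval 0)).ne_zero (by simp)
  · exact (h.map (eval 0)).ne_zero (by simp)

lemma exists_linearEquiv_eval_eq_standard {q : MvPolynomial (Fin 3) ℂ} (hq : q.IsHomogeneous 2)
    (hirr : Irreducible q) :
    ∃ T : (Fin 3 → ℂ) ≃ₗ[ℂ] (Fin 3 → ℂ), ∀ v, eval (T v) q = v 1 ^ 2 - 4 * v 0 * v 2 := by
  obtain ⟨Q, hQ⟩ := exists_quadraticForm_eq_eval hq
  have hd := Q.equivalent_weightedSumSquares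
  rw [Module.finrank_fin_fun] at hd
  obtain ⟨w, ⟨e⟩⟩ := hd
  have he : ∀ v, eval (e.toLinearEquiv.symm v) q = w 0 * v 0 ^ 2 + w 1 * v 1 ^ 2 + w 2 * v 2 ^ 2 := by
    intro v
    have h := e.map_app (e.toLinearEquiv.symm v)
    rw [← hQ, ← h]
    have : e (e.toLinearEquiv.symm v) = v := e.toLinearEquiv.apply_symm_apply v
    rw [this]
    simp [QuadraticMap.weightedSumSquares_apply, Fin.sum_univ_three, pow_two]
  have hw : ∀ i, w i ≠ 0 := by
    obtain ⟨φ, hφ, -⟩ := exists_algEquiv_of_linearEquiv e.toLinearEquiv.symm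
    have h1 : φ q = C (w 0) * X 0 ^ 2 + C (w 1) * X 1 ^ 2 + C (w 2) * X 2 ^ 2 :=
      MvPolynomial.funext fun v => by
      rw [hφ, he]
      simp
    have h2 : Irreducible (φ q) := (MulEquiv.irreducible_iff φ).2 hirr
    rw [h1] at h2
    intro i hi
    fin_cases i <;> simp only [Fin.zero_eta, Fin.mk_one, Fin.reduceFinMk] at hi <;>
      simp only [hi, map_zero, zero_mul, zero_add, add_zero] at h2 <;>
      exact not_irreducible_sq_add_sq _ _ _ _ h2
  choose u hu using fun i => IsAlgClosed.exists_eq_mul_self (w i)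
  have hu0 : ∀ i, u i ≠ 0 := fun i h => hw i (by rw [hu, h, zero_mul])
  have hu0' := hu0 0
  have hu1' := hu0 1
  have hu2' := hu0 2
  let S : (Fin 3 → ℂ) ≃ₗ[ℂ] (Fin 3 → ℂ) :=
    { toFun := fun v => ![(v 0 - v 2) / u 0, v 1 / u 1, Complex.I * (v 0 + v 2) / u 2]
      invFun := fun v => ![(u 0 * v 0 - Complex.I * u 2 * v 2) / 2, u 1 * v 1,
        (-Complex.I * u 2 * v 2 - u 0 * v 0) / 2]
      map_add' := fun v v' => by
        ext i
        fin_cases i <;> simp <;> ring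
      map_smul' := fun c v => by
        ext i
        fin_cases i <;> simp <;> ring
      left_inv := fun v => by
        ext i
        fin_cases i <;> simp <;> field_simp <;> ring_nf <;> simp [Complex.I_sq] <;> ring
      right_inv := fun v => by
        ext i
        fin_cases i <;> simp <;> field_simp <;> ring_nf <;> simp [Complex.I_sq] }
  refine ⟨S.trans e.toLinearEquiv.symm, fun v => ?_⟩
  have : S v = ![(v 0 - v 2) / u 0, v 1 / u 1, Complex.I * (v 0 + v 2) / u 2] := rfl
  rw [LinearEquiv.trans_apply, he, this, hu, hu, hu]
  simp
  field_simp
  ring_nf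
  simp [Complex.I_sq]
  ring

lemma eval_mk_rep_eq_zero_iff {F : MvPolynomial (Fin 3) ℂ} {r : ℕ} (hF : F.IsHomogeneous r)
    {v : Fin 3 → ℂ} (hv : v ≠ 0) :
    eval (Projectivization.mk ℂ v hv).rep F = 0 ↔ eval v F = 0 := by
  obtain ⟨a, ha⟩ := Projectivization.exists_smul_eq_mk_rep ℂ v hv
  rw [← ha, Units.smul_def, eval_smul_of_isHomogeneous hF]
  simp

lemma exists_two_roots {b₀ b₁ b₂ : ℂ} (h : b₁ ^ 2 ≠ b₀ * b₂) :
    ∃ s t : Fin 2 → ℂ, bracket s t ≠ 0 ∧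
      b₀ * s 0 ^ 2 + b₁ * (2 * s 0 * s 1) + b₂ * s 1 ^ 2 = 0 ∧
      b₀ * t 0 ^ 2 + b₁ * (2 * t 0 * t 1) + b₂ * t 1 ^ 2 = 0 := by
  by_cases h0 : b₀ = 0
  · subst h0
    have h1 : b₁ ≠ 0 := fun h1 => h (by simp [h1])
    refine ⟨![1, 0], ![-b₂, 2 * b₁], by simpa [bracket] using h1, by simp, ?_⟩
    simp
    ring
  · obtain ⟨δ, hδ⟩ := IsAlgClosed.exists_eq_mul_self (b₁ ^ 2 - b₀ * b₂)
    have hδ0 : δ ≠ 0 := by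
      rintro rfl
      exact h (by linear_combination hδ)
    refine ⟨![-b₁ + δ, b₀], ![-b₁ - δ, b₀], ?_, ?_, ?_⟩
    · have : bracket ![-b₁ + δ, b₀] ![-b₁ - δ, b₀] = 2 * δ * b₀ := by
        simp [bracket]
        ring
      rw [this]
      simp [hδ0, h0]
    · simp
      linear_combination -b₀ * hδ
    · simp
      linear_combination -b₀ * hδ

lemma exists_dual_coordinates {b₀ b₁ b₂ : ℂ} (h : b₁ ^ 2 = b₀ * b₂) :
    ∃ c : Fin 2 → ℂ, c 0 ^ 2 = b₀ ∧ c 0 * c 1 = b₁ ∧ c 1 ^ 2 = b₂ := by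
  obtain ⟨x, hx⟩ := IsAlgClosed.exists_eq_mul_self b₀
  obtain ⟨y, hy⟩ := IsAlgClosed.exists_eq_mul_self b₂
  have : (b₁ - x * y) * (b₁ + x * y) = 0 := by
    rw [hx, hy] at h
    linear_combination h
  rcases mul_eq_zero.1 this with h' | h'
  · exact ⟨![x, y], by simp [hx, pow_two], by simp; linear_combination -h', by simp [hy, pow_two]⟩
  · exact ⟨![x, -y], by simp [hx, pow_two], by simp; linear_combination -h', by simp [hy, pow_two]⟩

lemma exists_tangentForm_of_isTangent {q : MvPolynomial (Fin 3) ℂ} (hq : q.IsHomogeneous 2)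
    {T : (Fin 3 → ℂ) ≃ₗ[ℂ] (Fin 3 → ℂ)}
    (hT : ∀ v, eval (T v) q = v 1 ^ 2 - 4 * v 0 * v 2) {L : Set P2} (hL : IsLine L)
    (htan : IsTangent L {p : P2 | eval p.rep q = 0}) :
    ∃ c : Fin 2 → ℂ, c ≠ 0 ∧ L = {p : P2 | tangentForm c (T.symm p.rep) = 0} := by
  obtain ⟨a, ha, rfl⟩ := hL
  obtain ⟨p, hp⟩ := htan
  obtain ⟨b, hb⟩ : ∃ b : Fin 3 → ℂ, ∀ v, ∑ i, a i * T v i = b 0 * v 0 + b 1 * v 1 + b 2 * v 2 := by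
    refine ⟨fun j => ∑ i, a i * T (Pi.single j 1) i, fun v => ?_⟩
    conv_lhs => rw [pi_eq_sum_univ' v]
    simp [Fin.sum_univ_three]
    ring
  have hmem : ∀ v (hv : T v ≠ 0), v 1 ^ 2 - 4 * v 0 * v 2 = 0 →
      b 0 * v 0 + b 1 * v 1 + b 2 * v 2 = 0 → Projectivization.mk ℂ (T v) hv = p := by
    intro v hv h1 h2
    rw [← Set.mem_singleton_iff, ← hp]
    refine ⟨?_, (eval_mk_rep_eq_zero_iff hq hv).2 (by rw [hT, h1])⟩
    have h := eval_mk_rep_eq_zero_iff (isHomogeneous_linForm a) hv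
    simp only [linForm, map_sum, map_mul, eval_C, eval_X] at h
    exact h.2 (by rw [hb, h2])
  have hdisc : b 1 ^ 2 = b 0 * b 2 := by
    by_contra hne
    obtain ⟨s, t, hst, hs, ht⟩ := exists_two_roots hne
    have hne0 : ∀ s : Fin 2 → ℂ, s ≠ 0 → T (polarVeronese s s) ≠ 0 := by
      intro s hs h
      rw [LinearEquiv.map_eq_zero_iff] at h
      refine hs ?_
      ext k
      fin_cases k
      · simpa [polarVeronese] using congrFun h 0
      · simpa [polarVeronese] using congrFun h 2
    have hs0 : s ≠ 0 := by
      rintro rfl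
      simp [bracket] at hst
    have ht0 : t ≠ 0 := by
      rintro rfl
      simp [bracket] at hst
    have h1 := hmem _ (hne0 s hs0) (by simp [polarVeronese]; ring)
      (by simp [polarVeronese]; linear_combination hs)
    have h2 := hmem _ (hne0 t ht0) (by simp [polarVeronese]; ring)
      (by simp [polarVeronese]; linear_combination ht)
    rw [← h2, Projectivization.mk_eq_mk_iff'] at h1
    obtain ⟨k, hk⟩ := h1
    rw [← map_smul, T.injective.eq_iff] at hk
    have k0 := congrFun hk 0
    have k1 := congrFun hk 1
    have k2 := congrFun hk 2
    simp [polarVeronese] at k0 k1 k2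
    refine hst (pow_eq_zero_iff two_ne_zero |>.1 ?_)
    unfold bracket
    linear_combination -(t 1 ^ 2) * k0 + t 0 * t 1 * k1 - t 0 ^ 2 * k2
  obtain ⟨c, hc0, hc1, hc2⟩ := exists_dual_coordinates hdisc
  have hc : ∀ v, ∑ i, a i * v i = tangentForm c (T.symm v) := by
    intro v
    rw [tangentForm, hc0, hc1, hc2, ← hb, T.apply_symm_apply]
  refine ⟨c, ?_, by simp only [hc]⟩
  rintro rfl
  refine ha ?_
  ext i
  simpa [tangentForm, Pi.single_apply] using hc (Pi.single i 1)

lemma tangentForm_eq_zero_of_bracket_eq_zero {c d : Fin 2 → ℂ} (hd : d ≠ 0)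
    (h : bracket c d = 0) {v : Fin 3 → ℂ} (hv : tangentForm d v = 0) : tangentForm c v = 0 := by
  by_contra hne
  unfold bracket at h
  unfold tangentForm at *
  refine hd ?_
  ext k
  fin_cases k
  · have : d 0 ^ 2 * (c 0 ^ 2 * v 0 + c 0 * c 1 * v 1 + c 1 ^ 2 * v 2) = 0 := by
      linear_combination c 0 ^ 2 * hv - (c 0 * d 0 * v 1 + (c 0 * d 1 + c 1 * d 0) * v 2) * h
    simpa [hne] using this
  · have : d 1 ^ 2 * (c 0 ^ 2 * v 0 + c 0 * c 1 * v 1 + c 1 ^ 2 * v 2) = 0 := by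
      linear_combination c 1 ^ 2 * hv + ((c 0 * d 1 + c 1 * d 0) * v 0 + c 1 * d 1 * v 1) * h
    simpa [hne] using this

lemma bracket_ne_zero_of_ne {c d : Fin 2 → ℂ} (hc : c ≠ 0) (hd : d ≠ 0)
    {f : P2 → Fin 3 → ℂ}
    (hne : {p : P2 | tangentForm c (f p) = 0} ≠ {p : P2 | tangentForm d (f p) = 0}) :
    bracket c d ≠ 0 := by
  intro h
  have h' : bracket d c = 0 := by
    unfold bracket at *
    linear_combination -h
  exact hne (Set.ext fun p => ⟨tangentForm_eq_zero_of_bracket_eq_zero hc h',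
    tangentForm_eq_zero_of_bracket_eq_zero hd h⟩)

/-- **Theorem (c): irreducible curve of degree `r` through `X ∪ Y`, case `s = r`.**
Let `γ` be an irreducible conic, `r ≥ 2`, and `ℓ₁,…,ℓ_r, m₁,…,m_r` pairwise distinct lines
tangent to `γ`, defining contact star configurations `X` and `Y`.  Then some irreducible
homogeneous form of degree `r` vanishes at every point of `X ∪ Y`. -/
theorem irreducible_form_through_two_contact_stars_equal
    (γ : Set P2) (hγ : IsIrredConic γ) (r : ℕ) (hr : 2 ≤ r)
    (ℓ : Fin r → Set P2) (m : Fin r → Set P2)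
    (hℓline : ∀ i, IsLine (ℓ i)) (hmline : ∀ j, IsLine (m j))
    (hℓtan : ∀ i, IsTangent (ℓ i) γ) (hmtan : ∀ j, IsTangent (m j) γ)
    (hℓinj : Function.Injective ℓ) (hminj : Function.Injective m)
    (hcross : ∀ i j, ℓ i ≠ m j) :
    ∃ F : MvPolynomial (Fin 3) ℂ, F.IsHomogeneous r ∧ Irreducible F ∧
      ∀ p ∈ starConfig ℓ ∪ starConfig m, eval p.rep F = 0 := by
  obtain ⟨q, hq, hqirr, rfl⟩ := hγ
  obtain ⟨n, rfl⟩ : ∃ n, r = n + 1 := ⟨r - 1, by omega⟩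
  obtain ⟨T, hT⟩ := exists_linearEquiv_eval_eq_standard hq hqirr
  choose a ha0 ha using fun i => exists_tangentForm_of_isTangent hq hT (hℓline i) (hℓtan i)
  choose b hb0 hb using fun i => exists_tangentForm_of_isTangent hq hT (hmline i) (hmtan i)
  obtain ⟨F, hF, hFirr, hFv⟩ := exists_irreducible_form_of_tangentForms (show n ≠ 0 by omega)
    ha0 hb0
    (fun i j hij => bracket_ne_zero_of_ne (ha0 i) (ha0 j) (ha i ▸ ha j ▸ hℓinj.ne hij))
    (fun i j hij => bracket_ne_zero_of_ne (hb0 i) (hb0 j) (hb i ▸ hb j ▸ hminj.ne hij))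
    (fun i j => bracket_ne_zero_of_ne (ha0 i) (hb0 j) (ha i ▸ hb j ▸ hcross i j))
  obtain ⟨φ, hφ, hφhom⟩ := exists_algEquiv_of_linearEquiv T.symm
  refine ⟨φ F, hφhom F _ hF, (MulEquiv.irreducible_iff φ).2 hFirr, fun p hp => ?_⟩
  rw [hφ]
  refine hFv _ ((LinearEquiv.map_ne_zero_iff _).2 p.rep_nonzero) ?_
  rcases hp with ⟨i, j, hij, hi, hj⟩ | ⟨i, j, hij, hi, hj⟩
  · rw [ha] at hi hj
    exact Or.inl ⟨i, j, hij, hi, hj⟩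
  · rw [hb] at hi hj
    exact Or.inr ⟨i, j, hij, hi, hj⟩
end
end

section
/- Let γ ⊂ ℙ² be an irreducible conic and let ℓ₁, ℓ₂, ℓ₃, m₁, m₂, m₃ be six pairwise distinct lines tangent to γ, with X = 𝕊(ℓ₁,ℓ₂,ℓ₃) and Y = 𝕊(m₁,m₂,m₃) the corresponding contact star configurations (so X ∪ Y consists of six distinct points). If a nonzero homogeneous quadratic form in ℂ[x,y,z] vanishes at five of the six points of X ∪ Y, then it vanishes at all six points of X ∪ Y. -/
open MvPolynomial

noncomputable section

open scoped Matrix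

/-- The six quadratic monomials in three variables. -/
def veronese (v : Fin 3 → ℂ) : Fin 6 → ℂ :=
  ![v 0 ^ 2, v 1 ^ 2, v 2 ^ 2, v 1 * v 2, v 0 * v 2, v 0 * v 1]

/-- The ternary quadratic form with coefficients `c`. -/
def quadForm (c : Fin 6 → ℂ) (v : Fin 3 → ℂ) : ℂ := ∑ i, veronese v i * c i

/-- The polar bilinear form of `quadForm c`. -/
def polarForm (c : Fin 6 → ℂ) (u v : Fin 3 → ℂ) : ℂ :=
  2 * c 0 * u 0 * v 0 + 2 * c 1 * u 1 * v 1 + 2 * c 2 * u 2 * v 2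
    + c 3 * (u 1 * v 2 + u 2 * v 1) + c 4 * (u 0 * v 2 + u 2 * v 0)
    + c 5 * (u 0 * v 1 + u 1 * v 0)

/-- The half-discriminant of `quadForm c`. -/
def halfDisc (c : Fin 6 → ℂ) : ℂ :=
  4 * c 0 * c 1 * c 2 + c 3 * c 4 * c 5 - c 0 * c 3 ^ 2 - c 1 * c 4 ^ 2 - c 2 * c 5 ^ 2

/-- The coefficients of the dual quadratic form, whose matrix is the adjugate of the
polar matrix of `quadForm c`. -/
def dualCoeff (c : Fin 6 → ℂ) : Fin 6 → ℂ :=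
  ![4 * c 1 * c 2 - c 3 ^ 2, 4 * c 0 * c 2 - c 4 ^ 2, 4 * c 0 * c 1 - c 5 ^ 2,
    2 * (c 4 * c 5 - 2 * c 0 * c 3), 2 * (c 3 * c 5 - 2 * c 1 * c 4),
    2 * (c 3 * c 4 - 2 * c 2 * c 5)]

theorem quadForm_apply (c : Fin 6 → ℂ) (v : Fin 3 → ℂ) :
    quadForm c v = c 0 * v 0 ^ 2 + c 1 * v 1 ^ 2 + c 2 * v 2 ^ 2
      + c 3 * (v 1 * v 2) + c 4 * (v 0 * v 2) + c 5 * (v 0 * v 1) := by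
  simp [quadForm, veronese, Fin.sum_univ_succ]
  ring

theorem quadForm_smul (c : Fin 6 → ℂ) (r : ℂ) (v : Fin 3 → ℂ) :
    quadForm c (r • v) = r ^ 2 * quadForm c v := by
  simp only [quadForm_apply, Pi.smul_apply, smul_eq_mul]
  ring

theorem halfDisc_dualCoeff (c : Fin 6 → ℂ) :
    halfDisc (dualCoeff c) = 16 * halfDisc c ^ 2 := by
  simp [halfDisc, dualCoeff]
  ring

theorem dualCoeff_ne_zero {c : Fin 6 → ℂ} (hc : halfDisc c ≠ 0) : dualCoeff c ≠ 0 := by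
  intro h
  have := halfDisc_dualCoeff c
  rw [h] at this
  have h0 : halfDisc 0 = 0 := by simp [halfDisc]
  simp [h0, hc] at this

theorem exists_eval_eq_quadForm {q : MvPolynomial (Fin 3) ℂ} (hq : q.IsHomogeneous 2) :
    ∃ c, ∀ v, eval v q = quadForm c v := by
  have key : ∀ d ∈ q.support, ∃ c, ∀ v : Fin 3 → ℂ,
      q.coeff d * ∏ i, v i ^ d i = quadForm c v := by
    intro d hd
    have h := hq (mem_support_iff.mp hd)
    have h2 : d 0 + d 1 + d 2 = 2 := by
      rw [Finsupp.weight_apply, Finsupp.sum_fintype _ _ (by simp)] at h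
      simpa [Fin.sum_univ_three] using h
    have h0 : d 0 ≤ 2 := by omega
    have h1 : d 1 ≤ 2 := by omega
    simp only [Fin.prod_univ_three, quadForm_apply]
    obtain ⟨x, hx⟩ : ∃ x, d 0 = x := ⟨_, rfl⟩
    obtain ⟨y, hy⟩ : ∃ y, d 1 = y := ⟨_, rfl⟩
    obtain ⟨z, hz⟩ : ∃ z, d 2 = z := ⟨_, rfl⟩
    simp only [hx, hy, hz] at *
    generalize q.coeff d = r
    have : (x = 2 ∧ y = 0 ∧ z = 0) ∨ (x = 0 ∧ y = 2 ∧ z = 0) ∨ (x = 0 ∧ y = 0 ∧ z = 2) ∨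
        (x = 0 ∧ y = 1 ∧ z = 1) ∨ (x = 1 ∧ y = 0 ∧ z = 1) ∨ (x = 1 ∧ y = 1 ∧ z = 0) := by
      omega
    rcases this with ⟨rfl, rfl, rfl⟩ | ⟨rfl, rfl, rfl⟩ | ⟨rfl, rfl, rfl⟩ | ⟨rfl, rfl, rfl⟩ |
      ⟨rfl, rfl, rfl⟩ | ⟨rfl, rfl, rfl⟩
    · exact ⟨Pi.single 0 r, fun v => by simp⟩
    · exact ⟨Pi.single 1 r, fun v => by simp⟩
    · exact ⟨Pi.single 2 r, fun v => by simp⟩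
    · exact ⟨Pi.single 3 r, fun v => by simp⟩
    · exact ⟨Pi.single 4 r, fun v => by simp⟩
    · exact ⟨Pi.single 5 r, fun v => by simp⟩
  choose! c hc using key
  refine ⟨∑ d ∈ q.support, c d, fun v => ?_⟩
  rw [eval_eq', Finset.sum_congr rfl fun d hd => hc d hd v]
  simp only [quadForm, Finset.sum_apply, Finset.mul_sum]
  exact Finset.sum_comm

/-- A ternary quadratic form with vanishing discriminant is a product of linear forms. -/
theorem exists_factor_of_halfDisc_eq_zero {c : Fin 6 → ℂ} (hc : halfDisc c = 0) :
    ∃ u w : Fin 3 → ℂ, ∀ v, quadForm c v = (u ⬝ᵥ v) * (w ⬝ᵥ v) := by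
  have split : ∀ a b e : ℂ, b ^ 2 = 4 * a * e → ∃ s t : ℂ, s ^ 2 = a ∧ t ^ 2 = e ∧
      2 * s * t = b := by
    intro a b e h
    obtain ⟨s, hs⟩ := IsAlgClosed.exists_pow_nat_eq a (n := 2) (by norm_num)
    obtain ⟨t, ht⟩ := IsAlgClosed.exists_pow_nat_eq e (n := 2) (by norm_num)
    have : (b - 2 * s * t) * (b + 2 * s * t) = 0 := by
      subst hs ht
      linear_combination h
    rcases mul_eq_zero.mp this with h | h
    · exact ⟨s, t, hs, ht, by linear_combination -h⟩
    · exact ⟨s, -t, hs, by rw [neg_sq, ht], by linear_combination -h⟩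
  simp only [quadForm_apply, dotProduct, Fin.sum_univ_three]
  unfold halfDisc at hc
  by_cases h0 : c 0 = 0
  · by_cases h1 : c 1 = 0
    · by_cases h2 : c 2 = 0
      · have h : c 3 * c 4 * c 5 = 0 := by simpa [h0, h1, h2] using hc
        rcases mul_eq_zero.mp h with h | h
        · rcases mul_eq_zero.mp h with h | h
          · exact ⟨![1, 0, 0], ![0, c 5, c 4], fun v => by simp [h0, h1, h2, h]; ring⟩
          · exact ⟨![0, 1, 0], ![c 5, 0, c 3], fun v => by simp [h0, h1, h2, h]; ring⟩
        · exact ⟨![0, 0, 1], ![c 4, c 3, 0], fun v => by simp [h0, h1, h2, h]; ring⟩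
      · obtain ⟨s, t, hs, ht, hst⟩ := split (c 4 ^ 2 - 4 * c 2 * c 0)
          (2 * c 3 * c 4 - 4 * c 2 * c 5) (c 3 ^ 2 - 4 * c 2 * c 1)
          (by linear_combination (-16 * c 2) * hc)
        refine ⟨(4 * c 2)⁻¹ • ![c 4 - s, c 3 - t, 2 * c 2], ![c 4 + s, c 3 + t, 2 * c 2],
          fun v => ?_⟩
        simp
        field_simp
        linear_combination (v 0) ^ 2 * hs + (v 1) ^ 2 * ht + v 0 * v 1 * hst
    · obtain ⟨s, t, hs, ht, hst⟩ := split (c 5 ^ 2 - 4 * c 1 * c 0)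
        (2 * c 5 * c 3 - 4 * c 1 * c 4) (c 3 ^ 2 - 4 * c 1 * c 2)
        (by linear_combination (-16 * c 1) * hc)
      refine ⟨(4 * c 1)⁻¹ • ![c 5 - s, 2 * c 1, c 3 - t], ![c 5 + s, 2 * c 1, c 3 + t],
        fun v => ?_⟩
      simp
      field_simp
      linear_combination (v 0) ^ 2 * hs + (v 2) ^ 2 * ht + v 0 * v 2 * hst
  · obtain ⟨s, t, hs, ht, hst⟩ := split (c 5 ^ 2 - 4 * c 0 * c 1)
      (2 * c 5 * c 4 - 4 * c 0 * c 3) (c 4 ^ 2 - 4 * c 0 * c 2)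
      (by linear_combination (-16 * c 0) * hc)
    refine ⟨(4 * c 0)⁻¹ • ![2 * c 0, c 5 - s, c 4 - t], ![2 * c 0, c 5 + s, c 4 + t],
      fun v => ?_⟩
    simp
    field_simp
    linear_combination (v 1) ^ 2 * hs + (v 2) ^ 2 * ht + v 1 * v 2 * hst

theorem halfDisc_ne_zero_of_irreducible {q : MvPolynomial (Fin 3) ℂ} {c : Fin 6 → ℂ}
    (hq : Irreducible q) (hc : ∀ v, eval v q = quadForm c v) : halfDisc c ≠ 0 := by
  intro h
  obtain ⟨u, w, huw⟩ := exists_factor_of_halfDisc_eq_zero h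
  have not_unit (u : Fin 3 → ℂ) : ¬ IsUnit (∑ i, C (u i) * X i : MvPolynomial (Fin 3) ℂ) := by
    intro hu
    simpa using hu.map (eval (0 : Fin 3 → ℂ))
  have hfac : q = (∑ i, C (u i) * X i) * ∑ i, C (w i) * X i := by
    refine MvPolynomial.funext fun v => ?_
    simp [hc, huw, dotProduct]
  exact (hq.isUnit_or_isUnit hfac).elim (not_unit u) (not_unit w)

/-- The Gram determinant of three vectors for the polar form. -/
theorem gram_polarForm (c : Fin 6 → ℂ) (u v w : Fin 3 → ℂ) :
    4 * quadForm c u * quadForm c v * quadForm c w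
      + polarForm c v w * polarForm c u w * polarForm c u v
      - quadForm c u * polarForm c v w ^ 2 - quadForm c v * polarForm c u w ^ 2
      - quadForm c w * polarForm c u v ^ 2 = halfDisc c * (u ⨯₃ v ⬝ᵥ w) ^ 2 := by
  simp only [quadForm_apply, polarForm, halfDisc, cross_apply, dotProduct, Fin.sum_univ_three]
  simp
  ring

theorem polarForm_ne_zero {c : Fin 6 → ℂ} (hc : halfDisc c ≠ 0) {u v : Fin 3 → ℂ}
    (hu : quadForm c u = 0) (hv : quadForm c v = 0) (huv : u ⨯₃ v ≠ 0) :
    polarForm c u v ≠ 0 := by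
  intro h
  refine huv (dotProduct_eq_zero _ fun w => ?_)
  have := gram_polarForm c u v w
  simpa [hu, hv, h, hc] using this.symm

theorem cross_dot_ne_zero_of_quadForm_eq_zero {c : Fin 6 → ℂ} (hc : halfDisc c ≠ 0)
    {u v w : Fin 3 → ℂ} (hu : quadForm c u = 0) (hv : quadForm c v = 0) (hw : quadForm c w = 0)
    (huv : u ⨯₃ v ≠ 0) (huw : u ⨯₃ w ≠ 0) (hvw : v ⨯₃ w ≠ 0) : u ⨯₃ v ⬝ᵥ w ≠ 0 := by
  intro h
  have := gram_polarForm c u v w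
  simp [hu, hv, hw, h, polarForm_ne_zero hc hu hv huv, polarForm_ne_zero hc hu hw huw,
    polarForm_ne_zero hc hv hw hvw] at this

theorem exists_smul_eq_of_cross_eq_zero {u v : Fin 3 → ℂ} (hu : u ≠ 0) (h : u ⨯₃ v = 0) :
    ∃ r : ℂ, r • u = v := by
  by_contra! hr
  exact crossProduct_ne_zero_iff_linearIndependent.mpr
    ((LinearIndependent.pair_iff' hu).mpr hr) h

theorem exists_smul_cross_eq {a b v : Fin 3 → ℂ} (hab : a ⨯₃ b ≠ 0) (ha : a ⬝ᵥ v = 0)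
    (hb : b ⬝ᵥ v = 0) : ∃ r : ℂ, r • (a ⨯₃ b) = v := by
  refine exists_smul_eq_of_cross_eq_zero hab ?_
  simp only [dotProduct, Fin.sum_univ_three] at ha hb
  ext i
  fin_cases i <;> simp [cross_apply]
  · linear_combination b 0 * ha - a 0 * hb
  · linear_combination b 1 * ha - a 1 * hb
  · linear_combination b 2 * ha - a 2 * hb

/-- The zero locus in `ℙ²` of the linear form with coefficients `a`. -/
def lineOf (a : Fin 3 → ℂ) : Set P2 := {p : P2 | (∑ i, a i * p.rep i) = 0}

theorem mem_lineOf {a : Fin 3 → ℂ} {p : P2} : p ∈ lineOf a ↔ a ⬝ᵥ p.rep = 0 := Iff.rfl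

theorem exists_smul_rep (v : Fin 3 → ℂ) (hv : v ≠ 0) :
    ∃ r : ℂ, r ≠ 0 ∧ (Projectivization.mk ℂ v hv).rep = r • v := by
  obtain ⟨r, hr⟩ := Projectivization.exists_smul_eq_mk_rep ℂ v hv
  exact ⟨r, r.ne_zero, hr.symm⟩

theorem cross_ne_zero_of_lineOf_ne {a b : Fin 3 → ℂ} (ha : a ≠ 0) (hb : b ≠ 0)
    (h : lineOf a ≠ lineOf b) : a ⨯₃ b ≠ 0 := by
  intro hab
  obtain ⟨r, rfl⟩ := exists_smul_eq_of_cross_eq_zero ha hab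
  refine h (Set.ext fun p => ?_)
  have hr : r ≠ 0 := by
    rintro rfl
    simp at hb
  simp [mem_lineOf, hr]

/-- A line tangent to a conic lies on the dual conic. -/
theorem quadForm_dualCoeff_eq_zero_of_isTangent {c : Fin 6 → ℂ} {a : Fin 3 → ℂ} (ha : a ≠ 0)
    (h : IsTangent (lineOf a) {p : P2 | quadForm c p.rep = 0}) :
    quadForm (dualCoeff c) a = 0 := by
  obtain ⟨p, hp⟩ := h
  obtain ⟨hpa, hpc⟩ : p ∈ lineOf a ∩ {p : P2 | quadForm c p.rep = 0} := hp ▸ rfl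
  have huniq : ∀ x : Fin 3 → ℂ, a ⬝ᵥ x = 0 → quadForm c x = 0 → p.rep ⨯₃ x = 0 := by
    intro x hax hcx
    by_cases hx : x = 0
    · simp [hx]
    obtain ⟨r, hr, hrep⟩ := exists_smul_rep x hx
    have hmem : Projectivization.mk ℂ x hx ∈ lineOf a ∩ {p : P2 | quadForm c p.rep = 0} := by
      refine ⟨?_, ?_⟩
      · simp [mem_lineOf, hrep, hax]
      · simp [hrep, quadForm_smul, hcx]
    rw [hp, Set.mem_singleton_iff] at hmem
    rw [← hmem, hrep]
    simp
  rw [mem_lineOf] at hpa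
  replace hpc : quadForm c p.rep = 0 := hpc
  have hu0 := p.rep_nonzero
  generalize p.rep = u at *
  obtain ⟨w, hw⟩ : ∃ w, u ⬝ᵥ w ≠ 0 := by
    by_contra! hw
    exact hu0 (dotProduct_eq_zero _ hw)
  set v := a ⨯₃ w with hv
  have hav : a ⬝ᵥ v = 0 := dot_self_cross a w
  have huv : u ⨯₃ v = (u ⬝ᵥ w) • a := by
    simp only [dotProduct, Fin.sum_univ_three] at hpa
    ext i
    fin_cases i <;> simp [hv, cross_apply, dotProduct, Fin.sum_univ_three]
    · linear_combination -w 0 * hpa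
    · linear_combination -w 1 * hpa
    · linear_combination -w 2 * hpa
  have hgram : polarForm c u v ^ 2 - 4 * quadForm c u * quadForm c v =
      - quadForm (dualCoeff c) (u ⨯₃ v) := by
    simp [polarForm, quadForm_apply, dualCoeff, cross_apply]
    ring
  have hpol : polarForm c u v = 0 := by
    have hx := huniq (quadForm c v • u - polarForm c u v • v) (by simp [hpa, hav]) (by
      have : quadForm c (quadForm c v • u - polarForm c u v • v) =
          quadForm c v ^ 2 * quadForm c u := by
        have expand : ∀ s t : ℂ, quadForm c (s • u - t • v) =
            s ^ 2 * quadForm c u - s * t * polarForm c u v + t ^ 2 * quadForm c v := by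
          intro s t
          simp [quadForm_apply, polarForm]
          ring
        rw [expand]
        ring
      rw [this, hpc, mul_zero])
    simpa [huv, hw, ha] using hx
  rw [hpol, hpc, huv, quadForm_smul] at hgram
  simpa [hw] using hgram

/-- Six vectors on a common conic have linearly dependent squares. -/
theorem exists_relation_of_quadForm_eq_zero {b : Fin 6 → ℂ} (hb : b ≠ 0)
    {a : Fin 6 → Fin 3 → ℂ} (ha : ∀ k, quadForm b (a k) = 0) :
    ∃ d : Fin 6 → ℂ, d ≠ 0 ∧ ∀ c, ∑ k, d k * quadForm c (a k) = 0 := by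
  let M : Matrix (Fin 6) (Fin 6) ℂ := Matrix.of fun k => veronese (a k)
  have hM : M.det = 0 := Matrix.exists_mulVec_eq_zero_iff.mp ⟨b, hb, funext ha⟩
  obtain ⟨d, hd, hdM⟩ := Matrix.exists_vecMul_eq_zero_iff.mpr hM
  refine ⟨d, hd, fun c => ?_⟩
  have : d ⬝ᵥ (M *ᵥ c) = 0 := by rw [Matrix.dotProduct_mulVec, hdM, zero_dotProduct]
  exact this

/-- The coefficients of the product of two linear forms. -/
def mulCoeff (u w : Fin 3 → ℂ) : Fin 6 → ℂ :=
  ![u 0 * w 0, u 1 * w 1, u 2 * w 2, u 1 * w 2 + u 2 * w 1, u 0 * w 2 + u 2 * w 0,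
    u 0 * w 1 + u 1 * w 0]

theorem quadForm_mulCoeff (u w v : Fin 3 → ℂ) :
    quadForm (mulCoeff u w) v = (u ⬝ᵥ v) * (w ⬝ᵥ v) := by
  simp [quadForm_apply, mulCoeff, dotProduct, Fin.sum_univ_three]
  ring

theorem Fin.exists_range_eq_compl_pair {i j : Fin 6} (hij : i ≠ j) :
    ∃ f : Fin 4 ↪ Fin 6, Set.range f = {i, j}ᶜ := by
  have hcard : ({i, j}ᶜ : Finset (Fin 6)).card = 4 := by
    rw [Finset.card_compl, Finset.card_pair hij, Fintype.card_fin]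
  refine ⟨(Finset.orderEmbOfFin _ hcard).toEmbedding, ?_⟩
  rw [← Finset.coe_pair, ← Finset.coe_compl]
  exact Finset.range_orderEmbOfFin _ hcard

/-- A nontrivial relation between the squares of six vectors, no three of them dependent,
has no vanishing coefficient. -/
theorem relation_coeff_ne_zero {a : Fin 6 → Fin 3 → ℂ}
    (ha : ∀ i j k, i ≠ j → i ≠ k → j ≠ k → a i ⨯₃ a j ⬝ᵥ a k ≠ 0)
    {d : Fin 6 → ℂ} (hd : d ≠ 0) (hrel : ∀ c, ∑ k, d k * quadForm c (a k) = 0) (i : Fin 6) :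
    d i ≠ 0 := by
  intro hi
  refine hd (funext fun j => ?_)
  by_cases hij : i = j
  · simpa [← hij] using hi
  obtain ⟨f, hf⟩ := Fin.exists_range_eq_compl_pair hij
  have hfj (n : Fin 4) : f n ≠ j := fun h => by
    have : f n ∈ ({i, j}ᶜ : Set (Fin 6)) := hf ▸ Set.mem_range_self n
    simp [h] at this
  have hdet (n₁ n₂ : Fin 4) (hn : n₁ ≠ n₂) : a (f n₁) ⨯₃ a (f n₂) ⬝ᵥ a j ≠ 0 :=
    ha _ _ _ (f.injective.ne hn) (hfj _) (hfj _)
  have h := hrel (mulCoeff (a (f 0) ⨯₃ a (f 1)) (a (f 2) ⨯₃ a (f 3)))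
  rw [Finset.sum_eq_single j] at h
  · rw [quadForm_mulCoeff] at h
    simpa [hdet 0 1 (by decide), hdet 2 3 (by decide)] using h
  · intro k _ hkj
    rw [quadForm_mulCoeff]
    by_cases hki : k = i
    · simp [hki, hi]
    obtain ⟨n, rfl⟩ : k ∈ Set.range f := by
      rw [hf]
      simp [hki, hkj]
    fin_cases n <;> simp [dotProduct_comm _ (a _), dot_self_cross, dot_cross_self]
  · simp

/-- The vertices of the triangles with sides `a 0, a 1, a 2` and `a 3, a 4, a 5`. -/
def vertices (a : Fin 6 → Fin 3 → ℂ) : Fin 6 → Fin 3 → ℂ :=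
  ![a 1 ⨯₃ a 2, a 2 ⨯₃ a 0, a 0 ⨯₃ a 1, a 4 ⨯₃ a 5, a 5 ⨯₃ a 3, a 3 ⨯₃ a 4]

/-- The coefficients of the relation between the squares of the vertices of two triangles
induced by a relation between the squares of their sides. -/
def vertexCoeff (d : Fin 6 → ℂ) : Fin 6 → ℂ :=
  ![d 1 * d 2, d 2 * d 0, d 0 * d 1, -(d 4 * d 5), -(d 5 * d 3), -(d 3 * d 4)]

theorem sum_vertexCoeff_mul_quadForm_vertices {a : Fin 6 → Fin 3 → ℂ} {d : Fin 6 → ℂ}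
    (hrel : ∀ c, ∑ k, d k * quadForm c (a k) = 0) (c : Fin 6 → ℂ) :
    ∑ k, vertexCoeff d k * quadForm c (vertices a k) = 0 := by
  have hprod (u w : Fin 3 → ℂ) : ∑ k, d k * ((u ⬝ᵥ a k) * (w ⬝ᵥ a k)) = 0 := by
    simpa only [quadForm_mulCoeff] using hrel (mulCoeff u w)
  have hN (i j : Fin 3) : d 0 * (a 0 i * a 0 j) + d 1 * (a 1 i * a 1 j) + d 2 * (a 2 i * a 2 j) =
      -(d 3 * (a 3 i * a 3 j) + d 4 * (a 4 i * a 4 j) + d 5 * (a 5 i * a 5 j)) := by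
    have := hprod (Pi.single i 1) (Pi.single j 1)
    simp [Fin.sum_univ_six] at this
    linear_combination this
  have hadj (i j k l : Fin 3) := congrArg₂ (· - ·)
    (congrArg₂ (· * ·) (hN i k) (hN j l)) (congrArg₂ (· * ·) (hN i l) (hN j k))
  simp only [Fin.sum_univ_six, quadForm_apply, vertices, vertexCoeff, cross_apply]
  simp
  linear_combination c 0 * hadj 1 2 1 2 + c 1 * hadj 2 0 2 0 + c 2 * hadj 0 1 0 1
    + c 3 * hadj 2 0 0 1 + c 4 * hadj 1 2 0 1 + c 5 * hadj 1 2 2 0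

/-- The coefficient vectors of six pairwise distinct tangent lines determine a relation with
nonzero coefficients between the squares of the vertices of the two triangles they form. -/
theorem exists_vertices_relation {b : Fin 6 → ℂ} (hb : halfDisc b ≠ 0)
    {a : Fin 6 → Fin 3 → ℂ} (ha : ∀ k, quadForm b (a k) = 0)
    (hcross : ∀ i j, i ≠ j → a i ⨯₃ a j ≠ 0) :
    ∃ e : Fin 6 → ℂ, (∀ k, e k ≠ 0) ∧ ∀ c, ∑ k, e k * quadForm c (vertices a k) = 0 := by
  have hb0 : b ≠ 0 := by
    rintro rfl
    simp [halfDisc] at hb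
  obtain ⟨d, hd, hrel⟩ := exists_relation_of_quadForm_eq_zero hb0 ha
  have hd' := relation_coeff_ne_zero (fun i j k hij hik hjk =>
    cross_dot_ne_zero_of_quadForm_eq_zero hb (ha i) (ha j) (ha k) (hcross i j hij)
      (hcross i k hik) (hcross j k hjk)) hd hrel
  refine ⟨vertexCoeff d, fun k => ?_, sum_vertexCoeff_mul_quadForm_vertices hrel⟩
  fin_cases k <;> simp [vertexCoeff, hd']

theorem exists_smul_vertices_eq {a : Fin 6 → Fin 3 → ℂ}
    (hcross : ∀ i j, i ≠ j → a i ⨯₃ a j ≠ 0) {p : P2}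
    (hp : p ∈ starConfig (fun i : Fin 3 => lineOf (a (Fin.castAdd 3 i))) ∪
      starConfig (fun i : Fin 3 => lineOf (a (Fin.natAdd 3 i)))) :
    ∃ k, ∃ r : ℂ, r • vertices a k = p.rep := by
  have key (k i j : Fin 6) (hij : i ≠ j) (hk : vertices a k = a i ⨯₃ a j)
      (hi : p ∈ lineOf (a i)) (hj : p ∈ lineOf (a j)) :
      ∃ k, ∃ r : ℂ, r • vertices a k = p.rep :=
    ⟨k, hk ▸ exists_smul_cross_eq (hcross i j hij) hi hj⟩
  rcases hp with ⟨i, j, hij, hi, hj⟩ | ⟨i, j, hij, hi, hj⟩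
  · fin_cases i <;> fin_cases j <;> first | exact absurd rfl hij | skip
    · exact key 2 0 1 (by decide) rfl hi hj
    · exact key 1 2 0 (by decide) rfl hj hi
    · exact key 2 0 1 (by decide) rfl hj hi
    · exact key 0 1 2 (by decide) rfl hi hj
    · exact key 1 2 0 (by decide) rfl hi hj
    · exact key 0 1 2 (by decide) rfl hj hi
  · fin_cases i <;> fin_cases j <;> first | exact absurd rfl hij | skip
    · exact key 5 3 4 (by decide) rfl hi hj
    · exact key 4 5 3 (by decide) rfl hj hi
    · exact key 5 3 4 (by decide) rfl hj hi
    · exact key 3 4 5 (by decide) rfl hi hj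
    · exact key 4 5 3 (by decide) rfl hi hj
    · exact key 3 4 5 (by decide) rfl hj hi

/-- **A conic through five of the six points of `X ∪ Y` contains all six.**
Let `γ` be an irreducible conic and `ℓ₁,ℓ₂,ℓ₃, m₁,m₂,m₃` six pairwise distinct lines
tangent to `γ`, with contact star configurations `X = 𝕊(ℓ₁,ℓ₂,ℓ₃)` and
`Y = 𝕊(m₁,m₂,m₃)`.  If a nonzero homogeneous quadratic form vanishes at five of the six
points of `X ∪ Y`, then it vanishes at all six points. -/
theorem conic_through_five_contains_six
    (γ : Set P2) (hγ : IsIrredConic γ)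
    (ℓ : Fin 3 → Set P2) (m : Fin 3 → Set P2)
    (hℓline : ∀ i, IsLine (ℓ i)) (hmline : ∀ j, IsLine (m j))
    (hℓtan : ∀ i, IsTangent (ℓ i) γ) (hmtan : ∀ j, IsTangent (m j) γ)
    (hℓinj : Function.Injective ℓ) (hminj : Function.Injective m)
    (hcross : ∀ i j, ℓ i ≠ m j)
    (q : MvPolynomial (Fin 3) ℂ) (hq0 : q ≠ 0) (hq2 : q.IsHomogeneous 2)
    (A : Set P2) (hA : A ⊆ starConfig ℓ ∪ starConfig m) (hA5 : A.ncard = 5)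
    (hvan : ∀ p ∈ A, eval p.rep q = 0) :
    ∀ p ∈ starConfig ℓ ∪ starConfig m, eval p.rep q = 0 := by
  obtain ⟨g, hg2, hgirr, rfl⟩ := hγ
  obtain ⟨c, hc⟩ := exists_eval_eq_quadForm hg2
  obtain ⟨f, hf⟩ := exists_eval_eq_quadForm hq2
  have hdisc := halfDisc_ne_zero_of_irreducible hgirr hc
  simp only [hc] at hℓtan hmtan
  simp only [hf] at hvan ⊢
  choose s hs0 hs using hℓline
  choose t ht0 ht using hmline
  obtain rfl : ℓ = fun i => lineOf (s i) := funext hs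
  obtain rfl : m = fun i => lineOf (t i) := funext ht
  set a : Fin 6 → Fin 3 → ℂ := Fin.append s t with ha
  have hs' (i : Fin 3) : s i = a (Fin.castAdd 3 i) := by simp [ha]
  have ht' (i : Fin 3) : t i = a (Fin.natAdd 3 i) := (Fin.append_right s t i).symm
  clear_value a
  obtain rfl : s = fun i => a (Fin.castAdd 3 i) := funext hs'
  obtain rfl : t = fun i => a (Fin.natAdd 3 i) := funext ht'
  have ha0 (k : Fin 6) : a k ≠ 0 :=
    Fin.addCases (m := 3) (n := 3) (motive := fun k => a k ≠ 0) hs0 ht0 k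
  have hdual (k : Fin 6) : quadForm (dualCoeff c) (a k) = 0 :=
    quadForm_dualCoeff_eq_zero_of_isTangent (ha0 k) (Fin.addCases (m := 3) (n := 3)
      (motive := fun k => IsTangent (lineOf (a k)) {p : P2 | quadForm c p.rep = 0})
      hℓtan hmtan k)
  have hinj (i j : Fin 6) : i ≠ j → lineOf (a i) ≠ lineOf (a j) := by
    refine Fin.addCases (m := 3) (n := 3) (fun i => ?_) (fun i => ?_) i <;>
      refine Fin.addCases (m := 3) (n := 3) (fun j => ?_) (fun j => ?_) j <;> intro hij
    · exact fun h => hij (congrArg _ (hℓinj h))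
    · exact hcross i j
    · exact (hcross j i).symm
    · exact fun h => hij (congrArg _ (hminj h))
  have hcr (i j : Fin 6) (hij : i ≠ j) : a i ⨯₃ a j ≠ 0 :=
    cross_ne_zero_of_lineOf_ne (ha0 i) (ha0 j) (hinj i j hij)
  obtain ⟨e, he, hrel⟩ := exists_vertices_relation
    (by rw [halfDisc_dualCoeff]; simpa using hdisc) hdual hcr
  have hv0 (k : Fin 6) : vertices a k ≠ 0 := by
    fin_cases k <;> exact hcr _ _ (by decide)
  let P (k : Fin 6) : P2 := Projectivization.mk ℂ (vertices a k) (hv0 k)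
  have hP (k : Fin 6) : quadForm f (P k).rep = 0 ↔ quadForm f (vertices a k) = 0 := by
    obtain ⟨r, hr, hrep⟩ := exists_smul_rep _ (hv0 k)
    simp [P, hrep, quadForm_smul, hr]
  have hstar : ∀ p ∈ starConfig (fun i : Fin 3 => lineOf (a (Fin.castAdd 3 i))) ∪
      starConfig (fun i : Fin 3 => lineOf (a (Fin.natAdd 3 i))), ∃ k, P k = p := by
    intro p hp
    obtain ⟨k, r, hr⟩ := exists_smul_vertices_eq hcr hp
    refine ⟨k, ?_⟩
    rw [← p.mk_rep, Projectivization.mk_eq_mk_iff']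
    have hr0 : r ≠ 0 := by
      rintro rfl
      exact p.rep_nonzero (by simpa using hr.symm)
    exact ⟨r⁻¹, by rw [← hr, inv_smul_smul₀ hr0]⟩
  intro p hp
  by_cases hpA : p ∈ A
  · exact hvan p hpA
  obtain ⟨k₀, rfl⟩ := hstar p hp
  have hsub : A ⊆ P '' {k₀}ᶜ := by
    intro x hx
    obtain ⟨k, rfl⟩ := hstar x (hA hx)
    refine ⟨k, ?_, rfl⟩
    rintro rfl
    exact hpA hx
  have hcard : (P '' {k₀}ᶜ).ncard ≤ A.ncard := by
    refine (Set.ncard_image_le (Set.toFinite _)).trans ?_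
    rw [hA5, Set.ncard_compl]
    simp
  have hAeq : A = P '' {k₀}ᶜ := Set.eq_of_subset_of_ncard_le hsub hcard (Set.toFinite _)
  have hsum := hrel f
  rw [Finset.sum_eq_single k₀ (fun k _ hk => ?_) (by simp)] at hsum
  · rw [hP]
    exact (mul_eq_zero.mp hsum).resolve_left (he k₀)
  · rw [(hP k).mp (hvan _ (hAeq ▸ ⟨k, hk, rfl⟩)), mul_zero]

end
end
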